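/- Let α > −3, β ∈ ℝ and ρ > 0. There exist constants c, C > 0 (depending only on α, β, ρ) such that for every u ∈ ℝ³: c·⟨u⟩^{α+β} ≤ ∫_{ℝ³} |w|^α ⟨w⟩^β ⟨w+u⟩^α (μ(w+u))^ρ dw ≤ C·⟨u⟩^{α+β}. -/

import Mathlib

open MeasureTheory

/-- The standard Maxwellian `μ(v) = (2π)^(−d/2) exp(−|v|²/2)` on `ℝ^d`. -/
noncomputable def maxwellian (d : ℕ) (v : EuclideanSpace ℝ (Fin d)) : ℝ :=
  (2 * Real.pi) ^ (-(d : ℝ) / 2) * Real.exp (-‖v‖ ^ 2 / 2)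

/-- The Japanese bracket `⟨v⟩ = (1 + |v|²)^{1/2}`. -/
noncomputable def jap {d : ℕ} (v : EuclideanSpace ℝ (Fin d)) : ℝ :=
  Real.sqrt (1 + ‖v‖ ^ 2)


lemma aux_jap_one_le (v : (EuclideanSpace ℝ (Fin 3))) : 1 ≤ jap v := by
  unfold jap
  rw [Real.one_le_sqrt]
  nlinarith [sq_nonneg ‖v‖]

lemma aux_jap_pos (v : (EuclideanSpace ℝ (Fin 3))) : 0 < jap v := lt_of_lt_of_le one_pos (aux_jap_one_le v)

lemma aux_jap_sq (v : (EuclideanSpace ℝ (Fin 3))) : jap v ^ 2 = 1 + ‖v‖ ^ 2 := by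
  unfold jap
  rw [Real.sq_sqrt (by positivity)]

lemma aux_jap_cont : Continuous (fun v : (EuclideanSpace ℝ (Fin 3)) => jap v) := by
  unfold jap
  fun_prop

lemma aux_norm_le_jap (v : (EuclideanSpace ℝ (Fin 3))) : ‖v‖ ≤ jap v := by
  apply le_of_sq_le_sq _ (aux_jap_pos v).le
  rw [aux_jap_sq]; linarith

lemma aux_max_pos (v : (EuclideanSpace ℝ (Fin 3))) : 0 < maxwellian 3 v := by
  unfold maxwellian; positivity

lemma aux_max_cont : Continuous (fun v : (EuclideanSpace ℝ (Fin 3)) => maxwellian 3 v) := by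
  unfold maxwellian; fun_prop

lemma aux_peetre (a b v : (EuclideanSpace ℝ (Fin 3))) (h : ‖a‖ ≤ ‖b‖ + ‖v‖) : jap a ≤ jap b * (2 * jap v) := by
  have hb := aux_jap_pos b
  have hv := aux_jap_pos v
  apply le_of_sq_le_sq _ (by positivity)
  rw [mul_pow, mul_pow, aux_jap_sq, aux_jap_sq, aux_jap_sq]
  have h1 : ‖a‖ ^ 2 ≤ (‖b‖ + ‖v‖) ^ 2 := by gcongr
  nlinarith [sq_nonneg (‖b‖ - ‖v‖), mul_nonneg (sq_nonneg ‖b‖) (sq_nonneg ‖v‖),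
    sq_nonneg ‖b‖, sq_nonneg ‖v‖]

lemma aux_rpow (a b k s : ℝ) (ha : 0 < a) (hb : 0 < b) (hk : 0 < k) (h1 : a ≤ b * k)
    (h2 : b ≤ a * k) : a ^ s ≤ b ^ s * k ^ |s| := by
  rcases le_or_gt 0 s with hs | hs
  · rw [abs_of_nonneg hs, ← Real.mul_rpow hb.le hk.le]
    exact Real.rpow_le_rpow ha.le h1 hs
  · rw [abs_of_neg hs]
    have := Real.rpow_le_rpow_of_nonpos hb h2 hs.le
    rw [Real.mul_rpow ha.le hk.le] at this
    rw [Real.rpow_neg hk.le]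
    rw [← div_eq_mul_inv, le_div_iff₀ (by positivity)]
    exact this

/-- jap w ^ s vs jap u ^ s -/
lemma aux_jap_le (w u : (EuclideanSpace ℝ (Fin 3))) (s : ℝ) : jap w ^ s ≤ jap u ^ s * (2 * jap (w + u)) ^ |s| := by
  have := aux_jap_pos (w + u)
  refine aux_rpow _ _ _ _ (aux_jap_pos w) (aux_jap_pos u) (by positivity)
    (aux_peetre _ _ _ ?_) (aux_peetre _ _ _ ?_)
  · calc ‖w‖ = ‖(w + u) - u‖ := by simp
      _ ≤ _ := by rw [add_comm ‖u‖]; exact norm_sub_le _ _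
  · calc ‖u‖ = ‖(w + u) - w‖ := by simp
      _ ≤ _ := by rw [add_comm ‖w‖]; exact norm_sub_le _ _

lemma aux_jap_ge (w u : (EuclideanSpace ℝ (Fin 3))) (s : ℝ) : jap u ^ s ≤ jap w ^ s * (2 * jap (w + u)) ^ |s| := by
  rw [add_comm]; exact aux_jap_le u w s

lemma aux_jap_le_two (w : (EuclideanSpace ℝ (Fin 3))) (hw : 1 ≤ ‖w‖) : jap w ≤ ‖w‖ * 2 := by
  apply le_of_sq_le_sq _ (by positivity)
  rw [aux_jap_sq]; nlinarith

noncomputable def auxPhi (α : ℝ) : (EuclideanSpace ℝ (Fin 3)) → ℝ :=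
  (Metric.ball (0 : (EuclideanSpace ℝ (Fin 3))) 1).indicator (fun w => ‖w‖ ^ α)

lemma auxPhi_nonneg (α : ℝ) (w : (EuclideanSpace ℝ (Fin 3))) : 0 ≤ auxPhi α w :=
  Set.indicator_nonneg (fun _ _ => by positivity) _

lemma auxPhi_integrable (α : ℝ) (hα : -3 < α) : Integrable (auxPhi α) := by
  unfold auxPhi
  rw [integrable_indicator_iff measurableSet_ball]
  have := integrableOn_fun_norm_addHaar (volume : Measure (EuclideanSpace ℝ (Fin 3))) (f := fun r : ℝ => r ^ α) (r := 1)
  rw [this]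
  have h2 := (intervalIntegral.integrableOn_Ioo_rpow_iff (s := 2 + α) one_pos).2 (by linarith)
  refine h2.congr_fun (fun x hx => ?_) measurableSet_Ioo
  simp only [finrank_euclideanSpace, Fintype.card_fin, smul_eq_mul]
  rw [Real.rpow_add hx.1]
  norm_num

lemma aux_norm_le (α : ℝ) (w : (EuclideanSpace ℝ (Fin 3))) :
    ‖w‖ ^ α ≤ 2 ^ |α| * jap w ^ α * (1 + auxPhi α w) := by
  have hj := aux_jap_pos w
  rcases lt_or_ge ‖w‖ 1 with h | h
  · have hphi : auxPhi α w = ‖w‖ ^ α := by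
      unfold auxPhi
      rw [Set.indicator_of_mem (by simpa using h)]
    have h1 : (1 : ℝ) ^ α ≤ jap w ^ α * 2 ^ |α| := by
      refine aux_rpow _ _ _ _ one_pos hj two_pos ?_ ?_
      · linarith [aux_jap_one_le w]
      · apply le_of_sq_le_sq _ (by positivity)
        rw [aux_jap_sq]; nlinarith [norm_nonneg w]
    rw [Real.one_rpow] at h1
    rw [hphi]
    have h0 : 0 ≤ ‖w‖ ^ α := by positivity
    nlinarith
  · have h1 : ‖w‖ ^ α ≤ jap w ^ α * 2 ^ |α| := by
      refine aux_rpow _ _ _ _ (by linarith) hj two_pos ?_ (aux_jap_le_two w h)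
      linarith [aux_norm_le_jap w]
    have h2 := auxPhi_nonneg α w
    have h3 : 0 ≤ 2 ^ |α| * jap w ^ α := by positivity
    nlinarith

lemma aux_norm_ge (α : ℝ) (w : (EuclideanSpace ℝ (Fin 3))) (h : 1 ≤ ‖w‖) :
    jap w ^ α ≤ ‖w‖ ^ α * 2 ^ |α| := by
  refine aux_rpow _ _ _ _ (aux_jap_pos w) (by linarith) two_pos (aux_jap_le_two w h) ?_
  linarith [aux_norm_le_jap w, aux_jap_pos w]

lemma aux_gauss (q ρ : ℝ) (hρ : 0 < ρ) :
    ∃ M : ℝ, 0 < M ∧ ∀ v : (EuclideanSpace ℝ (Fin 3)), jap v ^ q * maxwellian 3 v ^ ρ ≤ M := by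
  set p : ℝ := (|q| + 1) / 2 with hp
  have hp0 : 0 < p := by positivity
  set c : ℝ := ρ / 2 with hc
  have hc0 : 0 < c := by positivity
  set A : ℝ := ((2 * Real.pi) ^ (-((3 : ℕ) : ℝ) / 2)) ^ ρ with hA
  have hA0 : 0 < A := by positivity
  refine ⟨A * (p / c) ^ p * Real.exp c, by positivity, fun v => ?_⟩
  have hj := aux_jap_pos v
  have hmax : maxwellian 3 v ^ ρ = A * (Real.exp c * Real.exp (-(c * jap v ^ 2))) := by
    unfold maxwellian
    rw [Real.mul_rpow (by positivity) (by positivity), ← Real.exp_mul, ← Real.exp_add,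
      aux_jap_sq, hA]
    congr 2
    rw [hc]; ring
  have h1 : jap v ^ q ≤ (jap v ^ 2) ^ p := by
    rw [← Real.rpow_natCast, ← Real.rpow_mul hj.le]
    apply Real.rpow_le_rpow_of_exponent_le (aux_jap_one_le v)
    rw [hp]; push_cast
    linarith [le_abs_self q]
  have h2 : (jap v ^ 2) ^ p ≤ (p / c) ^ p * Real.exp (c * jap v ^ 2) := by
    have h3 : jap v ^ 2 ≤ (p / c) * Real.exp (c * jap v ^ 2 / p) := by
      have := Real.add_one_le_exp (c * jap v ^ 2 / p)
      calc jap v ^ 2 = (p / c) * (c * jap v ^ 2 / p) := by field_simp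
        _ ≤ _ := by gcongr; linarith
    calc (jap v ^ 2) ^ p ≤ ((p / c) * Real.exp (c * jap v ^ 2 / p)) ^ p := by gcongr
      _ = _ := by
        rw [Real.mul_rpow (by positivity) (by positivity), ← Real.exp_mul]
        congr 2
        field_simp
  rw [hmax]
  calc jap v ^ q * (A * (Real.exp c * Real.exp (-(c * jap v ^ 2))))
      ≤ ((p / c) ^ p * Real.exp (c * jap v ^ 2)) *
        (A * (Real.exp c * Real.exp (-(c * jap v ^ 2)))) := by
        gcongr; exact h1.trans h2
    _ = A * (p / c) ^ p * Real.exp c *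
        (Real.exp (c * jap v ^ 2) * Real.exp (-(c * jap v ^ 2))) := by ring
    _ = _ := by rw [← Real.exp_add]; simp

noncomputable def auxF (α β ρ : ℝ) (u w : (EuclideanSpace ℝ (Fin 3))) : ℝ :=
  ‖w‖ ^ α * jap w ^ β * jap (w + u) ^ α * maxwellian 3 (w + u) ^ ρ

lemma auxF_nonneg (α β ρ : ℝ) (u w : (EuclideanSpace ℝ (Fin 3))) : 0 ≤ auxF α β ρ u w := by
  have := aux_jap_pos w
  have := aux_jap_pos (w + u)
  have := aux_max_pos (w + u)
  unfold auxF; positivity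

lemma auxF_meas (α β ρ : ℝ) (u : (EuclideanSpace ℝ (Fin 3))) : Measurable (auxF α β ρ u) := by
  have h1 := aux_jap_cont.measurable
  have h2 : Measurable (fun w : (EuclideanSpace ℝ (Fin 3)) => jap (w + u)) := h1.comp (measurable_add_const u)
  have h3 : Measurable (fun w : (EuclideanSpace ℝ (Fin 3)) => maxwellian 3 (w + u)) :=
    aux_max_cont.measurable.comp (measurable_add_const u)
  unfold auxF
  exact (((measurable_norm.pow_const α).mul (h1.pow_const β)).mul (h2.pow_const α)).mul
    (h3.pow_const ρ)

noncomputable def auxD (v : (EuclideanSpace ℝ (Fin 3))) : ℝ := jap v ^ (-4 : ℝ)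

lemma auxD_integrable : Integrable auxD := by
  have := integrable_rpow_neg_one_add_norm_sq (E := (EuclideanSpace ℝ (Fin 3))) (μ := volume) (r := 4) (by simp; norm_num)
  refine this.congr (Filter.Eventually.of_forall fun v => ?_)
  simp only [auxD]
  rw [← aux_jap_sq, ← Real.rpow_natCast, ← Real.rpow_mul (aux_jap_pos v).le]
  norm_num

lemma auxF_upper (α β ρ : ℝ) (hρ : 0 < ρ) : ∃ K : ℝ, 0 < K ∧ ∀ u w : (EuclideanSpace ℝ (Fin 3)),
    auxF α β ρ u w ≤ K * jap u ^ (α + β) * (auxD (w + u) + auxPhi α w) := by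
  obtain ⟨M, hM, hMv⟩ := aux_gauss (|α + β| + α + 4) ρ hρ
  refine ⟨2 ^ |α| * (2 ^ |α + β| * M), by positivity, fun u w => ?_⟩
  have hw := aux_jap_pos w
  have hu := aux_jap_pos u
  have hv := aux_jap_pos (w + u)
  have hm := aux_max_pos (w + u)
  have hphi := auxPhi_nonneg α w
  have hD0 : 0 < auxD (w + u) := by unfold auxD; positivity
  have hD1 : auxD (w + u) ≤ 1 :=
    Real.rpow_le_one_of_one_le_of_nonpos (aux_jap_one_le _) (by norm_num)
  have hG : (2 * jap (w + u)) ^ |α + β| * (jap (w + u) ^ α * maxwellian 3 (w + u) ^ ρ)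
      ≤ 2 ^ |α + β| * M * auxD (w + u) := by
    calc _ = 2 ^ |α + β| * (jap (w + u) ^ (|α + β| + α + 4) * maxwellian 3 (w + u) ^ ρ)
          * auxD (w + u) := by
          unfold auxD
          rw [Real.mul_rpow two_pos.le hv.le, Real.rpow_add hv, Real.rpow_add hv,
            Real.rpow_neg hv.le]
          field_simp
      _ ≤ _ := by gcongr; exact hMv _
  calc auxF α β ρ u w
      ≤ (2 ^ |α| * jap w ^ α * (1 + auxPhi α w)) * jap w ^ β * jap (w + u) ^ α
        * maxwellian 3 (w + u) ^ ρ := by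
        unfold auxF; gcongr; exact aux_norm_le α w
    _ = 2 ^ |α| * (1 + auxPhi α w) * jap w ^ (α + β) *
        (jap (w + u) ^ α * maxwellian 3 (w + u) ^ ρ) := by
        rw [Real.rpow_add hw]; ring
    _ ≤ 2 ^ |α| * (1 + auxPhi α w) * (jap u ^ (α + β) * (2 * jap (w + u)) ^ |α + β|) *
        (jap (w + u) ^ α * maxwellian 3 (w + u) ^ ρ) := by
        gcongr; exact aux_jap_le w u _
    _ = 2 ^ |α| * (1 + auxPhi α w) * jap u ^ (α + β) * ((2 * jap (w + u)) ^ |α + β| *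
        (jap (w + u) ^ α * maxwellian 3 (w + u) ^ ρ)) := by ring
    _ ≤ 2 ^ |α| * (1 + auxPhi α w) * jap u ^ (α + β) * (2 ^ |α + β| * M * auxD (w + u)) := by
        gcongr
    _ = 2 ^ |α| * (2 ^ |α + β| * M) * jap u ^ (α + β) *
        (auxD (w + u) + auxPhi α w * auxD (w + u)) := by ring
    _ ≤ _ := by
        gcongr
        exact mul_le_of_le_one_right hphi hD1

lemma auxF_lower (α β ρ : ℝ) : ∃ m : ℝ, 0 < m ∧ ∀ u w : (EuclideanSpace ℝ (Fin 3)), ‖w + u‖ ≤ 5 → 1 ≤ ‖w‖ →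
    m * jap u ^ (α + β) ≤ auxF α β ρ u w := by
  let F : (EuclideanSpace ℝ (Fin 3)) → ℝ := fun v =>
    jap v ^ α * maxwellian 3 v ^ ρ / (2 ^ |α| * (2 * jap v) ^ |α + β|)
  have hF : Continuous F := by
    have hp : ∀ v : (EuclideanSpace ℝ (Fin 3)), 0 < 2 * jap v := fun v => by have := aux_jap_pos v; positivity
    refine Continuous.div ?_ ?_ ?_
    · exact (aux_jap_cont.rpow_const fun v => Or.inl (aux_jap_pos v).ne').mul
        (aux_max_cont.rpow_const fun v => Or.inl (aux_max_pos v).ne')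
    · exact continuous_const.mul ((continuous_const.mul aux_jap_cont).rpow_const
        fun v => Or.inl (hp v).ne')
    · intro v
      have := hp v
      positivity
  obtain ⟨x, -, hx⟩ := (isCompact_closedBall (0 : (EuclideanSpace ℝ (Fin 3))) 5).exists_isMinOn
    ⟨0, by simp⟩ hF.continuousOn
  have hxj := aux_jap_pos x
  have hxm := aux_max_pos x
  refine ⟨F x, by simp only [F]; positivity, fun u w h5 h1 => ?_⟩
  have hw := aux_jap_pos w
  have hu := aux_jap_pos u
  have hv := aux_jap_pos (w + u)
  have hm := aux_max_pos (w + u)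
  have hle : F x ≤ F (w + u) := hx (by simpa using h5)
  have hFv : 0 ≤ F (w + u) := by simp only [F]; positivity
  calc F x * jap u ^ (α + β) ≤ F (w + u) * jap u ^ (α + β) := by gcongr
    _ ≤ F (w + u) * (jap w ^ (α + β) * (2 * jap (w + u)) ^ |α + β|) := by
        gcongr; exact aux_jap_ge w u _
    _ = F (w + u) * (jap w ^ α * jap w ^ β * (2 * jap (w + u)) ^ |α + β|) := by
        rw [Real.rpow_add hw]
    _ ≤ F (w + u) * ((‖w‖ ^ α * 2 ^ |α|) * jap w ^ β * (2 * jap (w + u)) ^ |α + β|) := by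
        gcongr; exact aux_norm_ge α w h1
    _ = auxF α β ρ u w := by
        simp only [F, auxF]
        field_simp

theorem weighted_maxwellian_integral_comparable
    (α β ρ : ℝ) (hα : -3 < α) (hρ : 0 < ρ) :
    ∃ c C : ℝ, 0 < c ∧ 0 < C ∧
      ∀ u : EuclideanSpace ℝ (Fin 3),
        c * jap u ^ (α + β) ≤
            (∫ w : EuclideanSpace ℝ (Fin 3),
              ‖w‖ ^ α * jap w ^ β * jap (w + u) ^ α * maxwellian 3 (w + u) ^ ρ) ∧
          (∫ w : EuclideanSpace ℝ (Fin 3),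
              ‖w‖ ^ α * jap w ^ β * jap (w + u) ^ α * maxwellian 3 (w + u) ^ ρ) ≤
            C * jap u ^ (α + β) := by
  obtain ⟨K, hK, hup⟩ := auxF_upper α β ρ hρ
  obtain ⟨m, hm, hlow⟩ := auxF_lower α β ρ
  have hI1 : 0 ≤ ∫ v, auxD v := integral_nonneg fun v => by
    have := aux_jap_pos v
    simp only [auxD]; positivity
  have hI2 : 0 ≤ ∫ w, auxPhi α w := integral_nonneg fun v => auxPhi_nonneg α v
  set V : ℝ := (volume : Measure (EuclideanSpace ℝ (Fin 3))).real (Metric.closedBall 0 5) -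
    (volume : Measure (EuclideanSpace ℝ (Fin 3))).real (Metric.ball 0 1) with hV
  have hV0 : 0 < V := by
    have hb : 0 < (volume : Measure (EuclideanSpace ℝ (Fin 3))).real (Metric.ball 0 1) :=
      ENNReal.toReal_pos (Metric.measure_ball_pos _ _ one_pos).ne' measure_ball_lt_top.ne
    have := Measure.addHaar_real_closedBall (volume : Measure (EuclideanSpace ℝ (Fin 3))) 0 (r := 5) (by norm_num)
    rw [hV, this]
    simp only [finrank_euclideanSpace, Fintype.card_fin]
    linarith
  refine ⟨m * V, K * ((∫ v, auxD v) + (∫ w, auxPhi α w) + 1), by positivity, by positivity,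
    fun u => ?_⟩
  change _ ≤ (∫ w, auxF α β ρ u w) ∧ (∫ w, auxF α β ρ u w) ≤ _
  have hu := aux_jap_pos u
  have hDi : Integrable (fun w => auxD (w + u)) := auxD_integrable.comp_add_right u
  have hPi := auxPhi_integrable α hα
  have hdom : Integrable
      (fun w => K * jap u ^ (α + β) * (auxD (w + u) + auxPhi α w)) :=
    (hDi.add hPi).const_mul _
  have hint : Integrable (auxF α β ρ u) := by
    refine hdom.mono' (auxF_meas α β ρ u).aestronglyMeasurable
      (Filter.Eventually.of_forall fun w => ?_)
    rw [Real.norm_of_nonneg (auxF_nonneg α β ρ u w)]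
    exact hup u w
  constructor
  · set S : Set (EuclideanSpace ℝ (Fin 3)) := Metric.closedBall (-u) 5 \ Metric.ball 0 1 with hS
    have hSm : MeasurableSet S := measurableSet_closedBall.diff measurableSet_ball
    have hSf : volume S ≠ ⊤ :=
      ((measure_mono Set.sdiff_subset).trans_lt measure_closedBall_lt_top).ne
    have hSV : V ≤ (volume : Measure (EuclideanSpace ℝ (Fin 3))).real S := by
      have h1 := le_measureReal_sdiff (μ := (volume : Measure (EuclideanSpace ℝ (Fin 3))))
        (s₁ := Metric.closedBall (-u) 5) (s₂ := Metric.ball 0 1)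
      have h2 : (volume : Measure (EuclideanSpace ℝ (Fin 3))).real (Metric.closedBall (-u) 5) =
          (volume : Measure (EuclideanSpace ℝ (Fin 3))).real (Metric.closedBall 0 5) := by
        rw [Measure.real, Measure.addHaar_closedBall_center]; rfl
      rw [hV, ← h2]; exact h1
    have h1 := setIntegral_ge_of_const_le_real (c := m * jap u ^ (α + β)) hSm hSf
      (f := auxF α β ρ u) (fun w hw => by
        apply hlow
        · simpa [dist_eq_norm] using hw.1
        · simpa using hw.2) hint.integrableOn
    have h2 := setIntegral_le_integral (s := S) hint
      (Filter.Eventually.of_forall (auxF_nonneg α β ρ u))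
    calc m * V * jap u ^ (α + β) = m * jap u ^ (α + β) * V := by ring
      _ ≤ m * jap u ^ (α + β) * (volume : Measure (EuclideanSpace ℝ (Fin 3))).real S := by gcongr
      _ ≤ _ := h1.trans h2
  · calc (∫ w, auxF α β ρ u w)
        ≤ ∫ w, K * jap u ^ (α + β) * (auxD (w + u) + auxPhi α w) :=
          integral_mono hint hdom (hup u)
      _ = K * jap u ^ (α + β) * ((∫ v, auxD v) + ∫ w, auxPhi α w) := by
          rw [integral_const_mul, integral_add hDi hPi, integral_add_right_eq_self auxD u]
      _ ≤ K * jap u ^ (α + β) * ((∫ v, auxD v) + (∫ w, auxPhi α w) + 1) := by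
          refine mul_le_mul_of_nonneg_left ?_ (by positivity)
          linarith
      _ = _ := by ring
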